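/- For every reduced word R of the longest element w_0 ∈ S_n and every triple 1 ≤ d < e < f ≤ n, one has Θ_R(d,e,f) = −T_R(d,e,f). Equivalently, the quantity Θ_R(d,e,f) + T_R(d,e,f) is independent of the reduced word R and equals 0. -/

import Mathlib

open scoped Classical

namespace BSDist

/-- The simple transposition `s i` (1-indexed): it swaps the values `i` and `i+1`
of `{1,…,n}`, i.e. the elements `i-1` and `i` of `Fin n`.  Out-of-range letters
give the identity. -/
def sTr (n : ℕ) (i : ℕ) : Equiv.Perm (Fin n) :=
  if h : 1 ≤ i ∧ i < n then Equiv.swap ⟨i - 1, by omega⟩ ⟨i, h.2⟩ else 1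

/-- The product `w(R) = s_{i₁} ⋯ s_{i_L}` of a word. -/
def wprod (n : ℕ) (R : List ℕ) : Equiv.Perm (Fin n) := (R.map (sTr n)).prod

/-- The Coxeter length of a permutation: its number of inversions. -/
def len {n : ℕ} (w : Equiv.Perm (Fin n)) : ℕ :=
  (Finset.univ.filter (fun p : Fin n × Fin n => p.1 < p.2 ∧ w p.2 < w p.1)).card

/-- A word over the alphabet `{1,…,n-1}`. -/
def Alphabet (n : ℕ) (R : List ℕ) : Prop := ∀ i ∈ R, 1 ≤ i ∧ i < n

/-- `R` is a reduced word (over the alphabet `{1,…,n-1}`). -/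
def IsReducedWord (n : ℕ) (R : List ℕ) : Prop :=
  Alphabet n R ∧ R.length = len (wprod n R)

/-- `R` is a reduced word for `w`. -/
def IsReducedWordFor (n : ℕ) (R : List ℕ) (w : Equiv.Perm (Fin n)) : Prop :=
  IsReducedWord n R ∧ wprod n R = w

/-- The weight `wt_R : S_n → ℤ[q]`, defined by the recursion
`wt_∅(e) = 1`, `wt_∅(x) = 0` for `x ≠ e`, and for an appended letter `i`:
`wt_{Ri}(x) = wt_R(x) + wt_R(x sᵢ)` if `ℓ(x sᵢ) > ℓ(x)`, and
`wt_{Ri}(x) = q·wt_R(x) + q·wt_R(x sᵢ)` if `ℓ(x sᵢ) < ℓ(x)`. -/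
noncomputable def wt (n : ℕ) (R : List ℕ) : Equiv.Perm (Fin n) → Polynomial ℤ :=
  R.foldl
    (fun f i x =>
      if len x < len (x * sTr n i) then f x + f (x * sTr n i)
      else Polynomial.X * f x + Polynomial.X * f (x * sTr n i))
    (fun x => if x = 1 then 1 else 0)

/-- A single commutation move: replace a consecutive factor `ij` by `ji` where
`|i - j| > 1`. -/
def CommMove (R R' : List ℕ) : Prop :=
  ∃ (A B : List ℕ) (i j : ℕ), (i + 1 < j ∨ j + 1 < i) ∧
    R = A ++ [i, j] ++ B ∧ R' = A ++ [j, i] ++ B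

/-- Commutation equivalence: a finite sequence of commutation moves. -/
def CommEquiv (R R' : List ℕ) : Prop := Relation.ReflTransGen CommMove R R'

/-- A single braid move: replace a consecutive factor `k(k+1)k` by `(k+1)k(k+1)`. -/
def BraidMove (R R' : List ℕ) : Prop :=
  ∃ (A B : List ℕ) (k : ℕ),
    R = A ++ [k, k + 1, k] ++ B ∧ R' = A ++ [k + 1, k, k + 1] ++ B

/-- The Demazure product of a word, computed left to right:
`w ∗ sᵢ = w sᵢ` if `ℓ(w sᵢ) > ℓ(w)`, and `w ∗ sᵢ = w` otherwise. -/
def dem (n : ℕ) (R : List ℕ) : Equiv.Perm (Fin n) :=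
  R.foldl (fun w i => if len w < len (w * sTr n i) then w * sTr n i else w) 1

/-- `app w t` is the value `w(t)` in 1-indexed one-line notation:
positions and values both run through `{1,…,n}`. -/
def app {n : ℕ} (w : Equiv.Perm (Fin n)) (t : ℕ) : ℕ :=
  if h : 1 ≤ t ∧ t ≤ n then ((w ⟨t - 1, by omega⟩ : Fin n) : ℕ) + 1 else 0

/-- `posOf x t = x⁻¹(t)`, the (1-indexed) position of the value `t` in `x`. -/
def posOf {n : ℕ} (x : Equiv.Perm (Fin n)) (t : ℕ) : ℕ := app x⁻¹ t

/-- The longest element `w₀` of `S_n` (the order-reversing permutation). -/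
def w0 (n : ℕ) : Equiv.Perm (Fin n) := ⟨Fin.rev, Fin.rev, Fin.rev_rev, Fin.rev_rev⟩

/-- The value pair `(a,b)` (with `a < b`) is an inversion of `x`:
`x⁻¹(a) > x⁻¹(b)`. -/
def IsInversion {n : ℕ} (x : Equiv.Perm (Fin n)) (a b : ℕ) : Prop :=
  posOf x b < posOf x a

/-- `tau R a b` is the first time `k` at which the pair `(a,b)` is an inversion
of the prefix product `s_{i₁} ⋯ s_{i_k}`. -/
noncomputable def tau (n : ℕ) (R : List ℕ) (a b : ℕ) : ℕ :=
  sInf {k | IsInversion (wprod n (R.take k)) a b}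

/-- `T_R(a,b,c) = +1` if `τ_R(a,b) < τ_R(b,c)` and `-1` otherwise. -/
noncomputable def T (n : ℕ) (R : List ℕ) (a b c : ℕ) : ℤ :=
  if tau n R a b < tau n R b c then 1 else -1

/-- `Supp(x) = {t : pos_x(t) ≠ pos_{w₀}(t)}`. -/
noncomputable def Supp (n : ℕ) (x : Equiv.Perm (Fin n)) : Finset ℕ :=
  (Finset.Icc 1 n).filter (fun t => posOf x t ≠ posOf (w0 n) t)

/-- `Fwd(x) = {t : pos_x(t) < pos_{w₀}(t)}`. -/
noncomputable def Fwd (n : ℕ) (x : Equiv.Perm (Fin n)) : Finset ℕ :=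
  (Finset.Icc 1 n).filter (fun t => posOf x t < posOf (w0 n) t)

/-- `Bwd(x) = {t : pos_x(t) > pos_{w₀}(t)}`. -/
noncomputable def Bwd (n : ℕ) (x : Equiv.Perm (Fin n)) : Finset ℕ :=
  (Finset.Icc 1 n).filter (fun t => posOf (w0 n) t < posOf x t)

/-- `D_R(x)`: the coefficient of `q^{N-1}` in `wt_R(x)`, where `N = n(n-1)/2`. -/
noncomputable def D (n : ℕ) (R : List ℕ) (x : Equiv.Perm (Fin n)) : ℤ :=
  (wt n R x).coeff (n * (n - 1) / 2 - 1)

/-- `σ_b(x) = sign(pos_x(b) − pos_{w₀}(b)) ∈ {−1,0,+1}`. -/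
noncomputable def sigmaVal (n : ℕ) (b : ℕ) (x : Equiv.Perm (Fin n)) : ℤ :=
  Int.sign ((posOf x b : ℤ) - (posOf (w0 n) b : ℤ))

/-- `Θ_R(a,b,c) = Σ_{x : Supp(x) = [a,c]} D_R(x)·σ_b(x)`. -/
noncomputable def Theta (n : ℕ) (R : List ℕ) (a b c : ℕ) : ℤ :=
  ∑ x ∈ Finset.univ.filter (fun x : Equiv.Perm (Fin n) => Supp n x = Finset.Icc a c),
    D n R x * sigmaVal n b x

end BSDist

namespace BSDist

lemma sTr_eq {n i : ℕ} (h : 1 ≤ i ∧ i < n) :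
    sTr n i = Equiv.swap (⟨i - 1, by omega⟩ : Fin n) ⟨i, h.2⟩ := by
  simp [sTr, h]

lemma sTr_mul_self (n i : ℕ) : sTr n i * sTr n i = 1 := by
  unfold sTr
  split_ifs with h
  · exact Equiv.swap_mul_self _ _
  · simp

/-- the inversions of a permutation -/
noncomputable def invs {n : ℕ} (w : Equiv.Perm (Fin n)) : Finset (Fin n × Fin n) :=
  Finset.univ.filter (fun p : Fin n × Fin n => p.1 < p.2 ∧ w p.2 < w p.1)

lemma len_eq_card {n : ℕ} (w : Equiv.Perm (Fin n)) : len w = (invs w).card := by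
  unfold len invs
  congr

lemma mem_invs {n : ℕ} (w : Equiv.Perm (Fin n)) (p q : Fin n) :
    (p, q) ∈ invs w ↔ p < q ∧ w q < w p := by
  unfold invs
  rw [Finset.mem_filter]
  simp

lemma swap_adj_lt {n : ℕ} {x y p q : Fin n} (hxy : (y : ℕ) = x + 1) (hpq : p < q)
    (hne : ¬ (p = x ∧ q = y)) : Equiv.swap x y p < Equiv.swap x y q := by
  simp only [Equiv.swap_apply_def]
  split_ifs <;> simp only [Fin.ext_iff, Fin.lt_def] at * <;> omega

lemma len_mul_swap {n : ℕ} {x y : Fin n} (hxy : (y : ℕ) = x + 1) (w : Equiv.Perm (Fin n))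
    (hw : w x < w y) : len (w * Equiv.swap x y) = len w + 1 := by
  rw [len_eq_card, len_eq_card]
  have hlt : x < y := by rw [Fin.lt_def]; omega
  have h1 : (x, y) ∈ invs (w * Equiv.swap x y) := by
    simp [mem_invs, hlt, hw]
  have h2 : (x, y) ∉ invs w := by
    simp [mem_invs, hlt, hw.le]
  rw [← Finset.card_erase_add_one h1]
  congr 1
  apply Finset.card_bij (fun p _ => (Equiv.swap x y p.1, Equiv.swap x y p.2))
  · rintro ⟨p, q⟩ h
    simp only [mem_invs, Finset.mem_erase,
      Equiv.Perm.mul_apply, ne_eq, Prod.mk.injEq] at h ⊢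
    exact ⟨swap_adj_lt hxy h.2.1 h.1, h.2.2⟩
  · rintro ⟨p, q⟩ _ ⟨p', q'⟩ _ h
    simpa using h
  · rintro ⟨p, q⟩ h
    have hne : ¬ (p = x ∧ q = y) := by
      rintro ⟨rfl, rfl⟩; exact h2 h
    simp only [mem_invs] at h
    refine ⟨(Equiv.swap x y p, Equiv.swap x y q), ?_, by simp⟩
    simp only [mem_invs, Finset.mem_erase,
      Equiv.Perm.mul_apply, ne_eq, Prod.mk.injEq, Equiv.swap_apply_self]
    refine ⟨?_, swap_adj_lt hxy h.1 hne, by simpa using h.2⟩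
    rintro ⟨h3, h4⟩
    have h5 : p = y := by rw [← Equiv.swap_apply_self x y p, h3]; simp
    have h6 : q = x := by rw [← Equiv.swap_apply_self x y q, h4]; simp
    subst h5 h6
    exact absurd h.1 (not_lt.mpr hlt.le)

lemma len_mul_swap' {n : ℕ} {x y : Fin n} (hxy : (y : ℕ) = x + 1) (w : Equiv.Perm (Fin n))
    (hw : w y < w x) : len w = len (w * Equiv.swap x y) + 1 := by
  have := len_mul_swap hxy (w * Equiv.swap x y) (by simpa using hw)
  simpa [mul_assoc] using this

lemma len_lt_swap_iff {n : ℕ} {x y : Fin n} (hxy : (y : ℕ) = x + 1) (w : Equiv.Perm (Fin n)) :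
    len w < len (w * Equiv.swap x y) ↔ w x < w y := by
  rcases lt_trichotomy (w x) (w y) with h | h | h
  · have := len_mul_swap hxy w h
    simp only [h, iff_true]; omega
  · have := w.injective h
    subst this; omega
  · have := len_mul_swap' hxy w h
    simp only [not_lt.mpr h.le, iff_false]; omega

lemma len_w0 (n : ℕ) : len (w0 n) = n * (n - 1) / 2 := by
  rw [← Finset.sum_range_id, len_eq_card]
  have : invs (w0 n) = Finset.univ.filter (fun p : Fin n × Fin n => p.1 < p.2) := by
    ext ⟨p, q⟩
    simp only [invs, Finset.mem_filter, Finset.mem_univ, true_and, w0, Equiv.coe_fn_mk, Fin.rev_lt_rev, and_self]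
  rw [this, Finset.card_filter, ← Finset.univ_product_univ, Finset.sum_product_right,
    ← Fin.sum_univ_eq_sum_range (fun i => i)]
  apply Finset.sum_congr rfl
  intro q _
  rw [← Finset.card_filter]
  have : (Finset.univ.filter (fun p : Fin n => p < q)) = Finset.Iio q := by ext; simp
  rw [this, Fin.card_Iio]

lemma wprod_append (n : ℕ) (A B : List ℕ) : wprod n (A ++ B) = wprod n A * wprod n B := by
  simp [wprod]

lemma wprod_snoc (n : ℕ) (A : List ℕ) (i : ℕ) : wprod n (A ++ [i]) = wprod n A * sTr n i := by
  simp [wprod]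

/-- every prefix of `R` extends by an ascent -/
def Asc (n : ℕ) (R : List ℕ) : Prop :=
  ∀ A i, (A ++ [i]) <+: R → ∃ x y : Fin n, (y : ℕ) = x + 1 ∧ sTr n i = Equiv.swap x y ∧
    wprod n A x < wprod n A y

lemma Asc.ofPre {n : ℕ} {R S : List ℕ} (h : Asc n R) (hS : S <+: R) : Asc n S :=
  fun A i hA => h A i (hA.trans hS)

lemma sTr_form {n i : ℕ} (h : 1 ≤ i ∧ i < n) :
    ∃ x y : Fin n, (y : ℕ) = x + 1 ∧ sTr n i = Equiv.swap x y :=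
  ⟨_, _, by simp only; omega, sTr_eq h⟩

lemma len_wprod_le {n : ℕ} (R : List ℕ) : Alphabet n R → len (wprod n R) ≤ R.length := by
  induction R using List.reverseRecOn with
  | nil =>
    intro _
    simp only [wprod, List.map_nil, List.prod_nil, List.length_nil, nonpos_iff_eq_zero]
    rw [len_eq_card, Finset.card_eq_zero]
    ext ⟨p, q⟩
    simp only [mem_invs, Equiv.Perm.one_apply,
      Finset.notMem_empty, iff_false, not_and, not_lt]
    exact fun h => h.le
  | append_singleton A i ih =>
    intro hal
    have h1 := ih (fun j hj => hal j (by simp [hj]))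
    obtain ⟨x, y, hxy, hs⟩ := sTr_form (hal i (by simp))
    rw [wprod_snoc, hs, List.length_append, List.length_singleton]
    rcases lt_trichotomy (wprod n A x) (wprod n A y) with h | h | h
    · rw [len_mul_swap hxy _ h]; omega
    · have := (wprod n A).injective h
      subst this; omega
    · have := len_mul_swap' hxy _ h
      omega

lemma asc_of_reduced {n : ℕ} (R : List ℕ) : IsReducedWord n R → Asc n R := by
  induction R using List.reverseRecOn with
  | nil =>
    intro _ A i h
    simp at h
  | append_singleton A i ih =>
    rintro ⟨hal, hl⟩
    have hal1 : Alphabet n A := fun j hj => hal j (by simp [hj])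
    have h1 := len_wprod_le A hal1
    obtain ⟨x, y, hxy, hs⟩ := sTr_form (hal i (by simp))
    rw [wprod_snoc, hs, List.length_append, List.length_singleton] at hl
    have key : wprod n A x < wprod n A y ∧ A.length = len (wprod n A) := by
      rcases lt_trichotomy (wprod n A x) (wprod n A y) with h | h | h
      · rw [len_mul_swap hxy _ h] at hl
        exact ⟨h, by omega⟩
      · have := (wprod n A).injective h
        subst this; omega
      · have := len_mul_swap' hxy _ h
        omega
    intro B j hB
    rcases List.prefix_concat_iff.mp hB with h | h
    · obtain ⟨rfl, h2⟩ := List.append_inj' h rfl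
      simp only [List.cons.injEq, and_true] at h2
      subst h2
      exact ⟨x, y, hxy, hs, key.1⟩
    · exact ih ⟨hal1, key.2⟩ B j h

lemma dem_snoc (n : ℕ) (R : List ℕ) (i : ℕ) : dem n (R ++ [i]) =
    if len (dem n R) < len (dem n R * sTr n i) then dem n R * sTr n i else dem n R := by
  unfold dem
  rw [List.foldl_append]
  simp only [List.foldl_cons, List.foldl_nil]


lemma wt_snoc (n : ℕ) (R : List ℕ) (i : ℕ) (x : Equiv.Perm (Fin n)) : wt n (R ++ [i]) x =
    if len x < len (x * sTr n i) then wt n R x + wt n R (x * sTr n i)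
      else Polynomial.X * wt n R x + Polynomial.X * wt n R (x * sTr n i) := by
  simp [wt, List.foldl_append]

lemma dem_eq_wprod {n : ℕ} (R : List ℕ) : Asc n R → dem n R = wprod n R := by
  induction R using List.reverseRecOn with
  | nil => intro _; rfl
  | append_singleton A i ih =>
    intro h
    obtain ⟨x, y, hxy, hs, hlt⟩ := h A i (List.prefix_refl _)
    rw [dem_snoc, ih (h.ofPre (List.prefix_append _ _)), wprod_snoc, hs,
      if_pos ((len_lt_swap_iff hxy _).mpr hlt)]

lemma wt_coeff_gt {n : ℕ} (R : List ℕ) : ∀ (x : Equiv.Perm (Fin n)) (m : ℕ), R.length < m →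
    (wt n R x).coeff m = 0 := by
  induction R using List.reverseRecOn with
  | nil =>
    intro x m hm
    simp only [List.length_nil] at hm
    simp only [wt, List.foldl_nil]
    split_ifs
    · rw [Polynomial.coeff_one, if_neg (by omega)]
    · simp
  | append_singleton A i ih =>
    intro x m hm
    simp only [List.length_append, List.length_singleton] at hm
    obtain ⟨m, rfl⟩ : ∃ k, m = k + 1 := ⟨m - 1, by omega⟩
    rw [wt_snoc]
    split_ifs
    · rw [Polynomial.coeff_add, ih _ _ (by omega), ih _ _ (by omega), add_zero]
    · rw [Polynomial.coeff_add, Polynomial.coeff_X_mul, Polynomial.coeff_X_mul,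
        ih _ _ (by omega), ih _ _ (by omega), add_zero]

/-- generic Demazure step indicator identity -/
lemma dem_step_ind {n : ℕ} {x y : Fin n} (hxy : (y : ℕ) = x + 1) (u z : Equiv.Perm (Fin n)) :
    (if len u < len (u * Equiv.swap x y) then (0 : ℤ) else
      (if z = u then 1 else 0) + (if z = u * Equiv.swap x y then 1 else 0)) =
    if (if len z < len (z * Equiv.swap x y) then z * Equiv.swap x y else z) = u then 1 else 0 := by
  simp only [len_lt_swap_iff hxy]
  have hne : x ≠ y := by intro h; rw [h] at hxy; omega
  have hss : ∀ a b : Equiv.Perm (Fin n), a * Equiv.swap x y = b ↔ a = b * Equiv.swap x y := by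
    intro a b
    constructor
    · rintro rfl; simp [mul_assoc]
    · rintro rfl; simp [mul_assoc]
  by_cases h1 : u x < u y
  · rw [if_pos h1, if_neg]
    split_ifs with h2
    · rw [hss]; rintro rfl
      simp only [Equiv.Perm.mul_apply, Equiv.swap_apply_left, Equiv.swap_apply_right] at h2
      exact lt_asymm h1 h2
    · rintro rfl; exact h2 h1
  · rw [if_neg h1]
    by_cases h2 : z x < z y
    · rw [if_pos h2, if_neg, zero_add]
      · simp only [hss]
      rintro rfl; exact h1 h2
    · rw [if_neg h2]
      have : z ≠ u * Equiv.swap x y := by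
        rintro rfl
        simp only [Equiv.Perm.mul_apply, Equiv.swap_apply_left, Equiv.swap_apply_right] at h2
        have := u.injective (le_antisymm (not_lt.mp h1) (not_lt.mp h2))
        exact hne this.symm
      rw [if_neg this, add_zero]

lemma wt_coeff_top {n : ℕ} (R : List ℕ) : Asc n R → ∀ (x : Equiv.Perm (Fin n)),
    (wt n R x).coeff R.length = if dem n R = x then 1 else 0 := by
  induction R using List.reverseRecOn with
  | nil =>
    intro _ x
    simp only [wt, dem, List.foldl_nil, List.length_nil]
    by_cases h : x = 1
    · simp [h]
    · simp [h, Ne.symm h]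
  | append_singleton A i ih =>
    intro hR u
    have ih := ih (hR.ofPre (List.prefix_append _ _))
    obtain ⟨x, y, hxy, hs, hlt⟩ := hR A i (List.prefix_refl _)
    rw [wt_snoc, dem_snoc, hs, ← dem_step_ind hxy, List.length_append, List.length_singleton]
    split_ifs with h
    · rw [Polynomial.coeff_add, wt_coeff_gt _ _ _ (by omega), wt_coeff_gt _ _ _ (by omega),
        add_zero]
    · all_goals rw [Polynomial.coeff_add, Polynomial.coeff_X_mul, Polynomial.coeff_X_mul, ih, ih]
      all_goals simp_all
    · all_goals rw [Polynomial.coeff_add, Polynomial.coeff_X_mul, Polynomial.coeff_X_mul, ih, ih]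
      all_goals simp_all
    · all_goals rw [Polynomial.coeff_add, Polynomial.coeff_X_mul, Polynomial.coeff_X_mul, ih, ih]
      all_goals simp_all
    · all_goals rw [Polynomial.coeff_add, Polynomial.coeff_X_mul, Polynomial.coeff_X_mul, ih, ih]
      all_goals simp_all

lemma wt_coeff_sub {n : ℕ} (R : List ℕ) : Asc n R → ∀ (u : Equiv.Perm (Fin n)),
    (Polynomial.X * wt n R u).coeff R.length =
      ∑ k ∈ Finset.range R.length, if dem n (R.eraseIdx k) = u then (1 : ℤ) else 0 := by
  induction R using List.reverseRecOn with
  | nil =>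
    intro _ x
    simp
  | append_singleton A i ih =>
    intro hR u
    have hA := hR.ofPre (List.prefix_append _ _)
    have ih := ih hA
    obtain ⟨x, y, hxy, hs, hlt⟩ := hR A i (List.prefix_refl _)
    rw [List.length_append, List.length_singleton, Finset.sum_range_succ, Polynomial.coeff_X_mul,
      wt_snoc, hs]
    have e1 : (A ++ [i]).eraseIdx A.length = A := by
      rw [List.eraseIdx_append_of_length_le (le_refl _)]; simp
    have e2 : ∀ k ∈ Finset.range A.length,
        (if dem n ((A ++ [i]).eraseIdx k) = u then (1 : ℤ) else 0) =
        (if len u < len (u * Equiv.swap x y) then (0 : ℤ) else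
      (if dem n (A.eraseIdx k) = u then 1 else 0) +
        (if dem n (A.eraseIdx k) = u * Equiv.swap x y then 1 else 0)) := by
      intro k hk
      rw [List.eraseIdx_append_of_lt_length (Finset.mem_range.mp hk), dem_snoc, hs,
        dem_step_ind hxy]
    rw [Finset.sum_congr rfl e2, e1]
    have hd := dem_eq_wprod A hA
    by_cases h : len u < len (u * Equiv.swap x y)
    · simp only [if_pos h, Finset.sum_const_zero, zero_add]
      rw [Polynomial.coeff_add, wt_coeff_top A hA, wt_coeff_top A hA, hd,
        if_neg (c := wprod n A = u * _), add_zero]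
      intro h2
      rw [len_lt_swap_iff hxy] at h
      rw [h2] at hlt
      simp only [Equiv.Perm.mul_apply, Equiv.swap_apply_left, Equiv.swap_apply_right] at hlt
      exact lt_asymm h hlt
    · simp only [if_neg h]
      rw [Polynomial.coeff_add, ih, ih, Finset.sum_add_distrib, hd,
        if_neg (c := wprod n A = u), add_zero]
      rintro rfl
      exact h ((len_lt_swap_iff hxy _).mpr hlt)

lemma inv_app_self {n : ℕ} (u : Equiv.Perm (Fin n)) (p : Fin n) : u⁻¹ (u p) = p := by
  simp

/-- the sorting (Demazure) step -/
noncomputable def dstep {n : ℕ} (x y : Fin n) (v : Equiv.Perm (Fin n)) : Equiv.Perm (Fin n) :=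
  if v x < v y then v * Equiv.swap x y else v

lemma dstep_bits_x {n : ℕ} {x y : Fin n} (v : Equiv.Perm (Fin n)) (θ : ℕ) :
    θ ≤ (dstep x y v x : ℕ) ↔ θ ≤ (v x : ℕ) ∨ θ ≤ (v y : ℕ) := by
  unfold dstep
  split_ifs with h <;> simp <;> rw [Fin.lt_def] at h <;> omega

lemma dstep_bits_y {n : ℕ} {x y : Fin n} (v : Equiv.Perm (Fin n)) (θ : ℕ) :
    θ ≤ (dstep x y v y : ℕ) ↔ θ ≤ (v x : ℕ) ∧ θ ≤ (v y : ℕ) := by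
  unfold dstep
  split_ifs with h <;> simp <;> rw [Fin.lt_def] at h <;> omega

lemma dstep_ne {n : ℕ} {x y p : Fin n} (v : Equiv.Perm (Fin n)) (hx : p ≠ x) (hy : p ≠ y) :
    dstep x y v p = v p := by
  unfold dstep
  split_ifs with h
  · simp [Equiv.swap_apply_of_ne_of_ne hx hy]
  · rfl

/-- single-discrepancy invariant for the threshold `θ` -/
def Disc {n : ℕ} (θ : ℕ) (A B : Fin n → Prop) (u v : Equiv.Perm (Fin n)) : Prop :=
  ∃ P Q : Fin n, A (u P) ∧ (∀ p, A (u p) → p ≤ P) ∧ B (u Q) ∧ (∀ p, B (u p) → Q ≤ p) ∧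
    ∀ p, θ ≤ (v p : ℕ) ↔ (θ ≤ (u p : ℕ) ∧ p ≠ P) ∨ p = Q

lemma Disc.step {n : ℕ} {θ : ℕ} {A B : Fin n → Prop} {u v : Equiv.Perm (Fin n)} {x y : Fin n}
    (hxy : (y : ℕ) = x + 1) (hu : u x < u y)
    (hA : ∀ c : Fin n, A c → θ ≤ (c : ℕ)) (hB : ∀ c : Fin n, B c → (c : ℕ) < θ)
    (hAc : A (u y) → θ ≤ (u x : ℕ) → A (u x)) (hBc : B (u x) → (u y : ℕ) < θ → B (u y))
    (hAB : ∀ p q, A (u p) → B (u q) → p < q)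
    (h : Disc θ A B u v) : Disc θ A B (u * Equiv.swap x y) (dstep x y v) := by
  obtain ⟨P, Q, hP, hPm, hQ, hQm, hb⟩ := h
  have hne : x ≠ y := by intro h; rw [h] at hxy; omega
  have hPQ := hAB P Q hP hQ
  have ux : (u * Equiv.swap x y) x = u y := by simp
  have uy : (u * Equiv.swap x y) y = u x := by simp
  have uo : ∀ p, p ≠ x → p ≠ y → (u * Equiv.swap x y) p = u p := by
    intro p h1 h2; simp [Equiv.swap_apply_of_ne_of_ne h1 h2]
  have vx := dstep_bits_x (x := x) (y := y) v θ
  have vy := dstep_bits_y (x := x) (y := y) v θ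
  have vo : ∀ p, p ≠ x → p ≠ y → dstep x y v p = v p := fun p h1 h2 => dstep_ne v h1 h2
  generalize u * Equiv.swap x y = u' at *
  generalize dstep x y v = v' at *
  rw [Fin.lt_def] at hu
  have hbx := hb x
  have hby := hb y
  have hAP := hA _ hP
  have hBQ := hB _ hQ
  obtain ⟨P', hP', hPm', hPd⟩ : ∃ P', A (u' P') ∧ (∀ p, A (u' p) → p ≤ P') ∧
      ((P = x ∧ P' = y ∧ θ ≤ (u x : ℕ)) ∨ (P = y ∧ P' = y ∧ θ ≤ (u x : ℕ)) ∨
        (P = y ∧ P' = x ∧ (u x : ℕ) < θ ∧ θ ≤ (u y : ℕ)) ∨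
        (P ≠ x ∧ P ≠ y ∧ P' = P)) := by
    have trans : ∀ p, A (u' p) → (p = x ∧ A (u y)) ∨ (p = y ∧ A (u x)) ∨ (p ≠ x ∧ p ≠ y ∧ A (u p)) := by
      intro p hp
      by_cases h1 : p = x
      · subst h1; rw [ux] at hp; exact Or.inl ⟨rfl, hp⟩
      · by_cases h2 : p = y
        · subst h2; rw [uy] at hp; exact Or.inr (Or.inl ⟨rfl, hp⟩)
        · rw [uo p h1 h2] at hp; exact Or.inr (Or.inr ⟨h1, h2, hp⟩)
    by_cases h1 : P = x
    · refine ⟨y, by rw [uy, ← h1]; exact hP, ?_, Or.inl ⟨h1, rfl, by rw [← h1]; exact hAP⟩⟩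
      intro p hp
      rcases trans p hp with ⟨h, -⟩ | ⟨h, -⟩ | ⟨-, -, h⟩
      · rw [Fin.le_def, h]; omega
      · exact h.le
      · have := hPm p h; rw [Fin.le_def] at *; rw [h1] at this; omega
    · by_cases h2 : P = y
      · by_cases h3 : θ ≤ (u x : ℕ)
        · refine ⟨y, by rw [uy]; exact hAc (h2 ▸ hP) h3, ?_, Or.inr (Or.inl ⟨h2, rfl, h3⟩)⟩
          intro p hp
          rcases trans p hp with ⟨h, -⟩ | ⟨h, -⟩ | ⟨-, -, h⟩
          · rw [Fin.le_def, h]; omega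
          · exact h.le
          · have := hPm p h; rw [h2] at this; exact this
        · refine ⟨x, by rw [ux]; exact (h2 ▸ hP), ?_,
            Or.inr (Or.inr (Or.inl ⟨h2, rfl, by omega, by rw [← h2]; exact hAP⟩))⟩
          intro p hp
          rcases trans p hp with ⟨h, -⟩ | ⟨h, h'⟩ | ⟨-, h', h⟩
          · exact h.le
          · exact absurd (hA _ h') h3
          · have := hPm p h; rw [Fin.le_def] at *; rw [h2] at this
            have : (p : ℕ) ≠ y := fun h => h' (Fin.ext h)
            omega
      · refine ⟨P, by rw [uo P h1 h2]; exact hP, ?_, Or.inr (Or.inr (Or.inr ⟨h1, h2, rfl⟩))⟩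
        have h1' : (P : ℕ) ≠ x := fun h => h1 (Fin.ext h)
        have h2' : (P : ℕ) ≠ y := fun h => h2 (Fin.ext h)
        intro p hp
        rcases trans p hp with ⟨h, h'⟩ | ⟨h, h'⟩ | ⟨-, -, h⟩
        · have := hPm _ h'; rw [Fin.le_def] at *; rw [h]; omega
        · have := hPm _ h'; rw [Fin.le_def] at *; rw [h]; omega
        · exact hPm p h
  obtain ⟨Q', hQ', hQm', hQd⟩ : ∃ Q', B (u' Q') ∧ (∀ p, B (u' p) → Q' ≤ p) ∧
      ((Q = y ∧ Q' = x ∧ (u y : ℕ) < θ) ∨ (Q = x ∧ Q' = x ∧ (u y : ℕ) < θ) ∨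
        (Q = x ∧ Q' = y ∧ (u x : ℕ) < θ ∧ θ ≤ (u y : ℕ)) ∨
        (Q ≠ x ∧ Q ≠ y ∧ Q' = Q)) := by
    have trans : ∀ p, B (u' p) → (p = x ∧ B (u y)) ∨ (p = y ∧ B (u x)) ∨ (p ≠ x ∧ p ≠ y ∧ B (u p)) := by
      intro p hp
      by_cases h1 : p = x
      · subst h1; rw [ux] at hp; exact Or.inl ⟨rfl, hp⟩
      · by_cases h2 : p = y
        · subst h2; rw [uy] at hp; exact Or.inr (Or.inl ⟨rfl, hp⟩)
        · rw [uo p h1 h2] at hp; exact Or.inr (Or.inr ⟨h1, h2, hp⟩)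
    by_cases h1 : Q = y
    · refine ⟨x, by rw [ux, ← h1]; exact hQ, ?_, Or.inl ⟨h1, rfl, by rw [← h1]; exact hBQ⟩⟩
      intro p hp
      rcases trans p hp with ⟨h, -⟩ | ⟨h, -⟩ | ⟨-, -, h⟩
      · exact h.ge
      · rw [Fin.le_def, h]; omega
      · have := hQm p h; rw [Fin.le_def] at *; rw [h1] at this; omega
    · by_cases h2 : Q = x
      · by_cases h3 : (u y : ℕ) < θ
        · refine ⟨x, by rw [ux]; exact hBc (h2 ▸ hQ) h3, ?_, Or.inr (Or.inl ⟨h2, rfl, h3⟩)⟩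
          intro p hp
          rcases trans p hp with ⟨h, -⟩ | ⟨h, -⟩ | ⟨-, -, h⟩
          · exact h.ge
          · rw [Fin.le_def, h]; omega
          · have := hQm p h; rw [h2] at this; exact this
        · refine ⟨y, by rw [uy]; exact (h2 ▸ hQ), ?_,
            Or.inr (Or.inr (Or.inl ⟨h2, rfl, by rw [← h2]; exact hBQ, by omega⟩))⟩
          intro p hp
          rcases trans p hp with ⟨h, h'⟩ | ⟨h, -⟩ | ⟨h', -, h⟩
          · exact absurd (hB _ h') h3
          · exact h.ge
          · have := hQm p h; rw [Fin.le_def] at *; rw [h2] at this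
            have : (p : ℕ) ≠ x := fun h => h' (Fin.ext h)
            omega
      · refine ⟨Q, by rw [uo Q h2 h1]; exact hQ, ?_, Or.inr (Or.inr (Or.inr ⟨h2, h1, rfl⟩))⟩
        have h1' : (Q : ℕ) ≠ x := fun h => h2 (Fin.ext h)
        have h2' : (Q : ℕ) ≠ y := fun h => h1 (Fin.ext h)
        intro p hp
        rcases trans p hp with ⟨h, h'⟩ | ⟨h, h'⟩ | ⟨-, -, h⟩
        · have := hQm _ h'; rw [Fin.le_def] at *; rw [h]; omega
        · have := hQm _ h'; rw [Fin.le_def] at *; rw [h]; omega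
        · exact hQm p h
  refine ⟨P', Q', hP', hPm', hQ', hQm', ?_⟩
  have hPQn : P ≠ Q := hPQ.ne
  have hnot : ¬ (P = y ∧ Q = x) := by
    rintro ⟨rfl, rfl⟩; rw [Fin.lt_def] at hPQ; omega
  clear hP' hPm' hQ' hQm' hP hPm hQ hQm hA hB hAc hBc hAB hAP hBQ hPQ
  intro p
  by_cases h1 : p = x
  · subst h1
    rw [vx, ux, hbx, hby]
    clear hb vx vy vo uo ux uy hbx hby
    grind
  · by_cases h2 : p = y
    · subst h2
      rw [vy, uy, hbx, hby]
      clear hb vx vy vo uo ux uy hbx hby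
      grind
    · rw [vo p h1 h2, uo p h1 h2, hb p]
      clear hb vx vy vo uo ux uy hbx hby
      grind

lemma dem_snoc' {n : ℕ} {x y : Fin n} (hxy : (y : ℕ) = x + 1) (R : List ℕ) (i : ℕ)
    (hs : sTr n i = Equiv.swap x y) : dem n (R ++ [i]) = dstep x y (dem n R) := by
  rw [dem_snoc, hs]
  unfold dstep
  simp only [len_lt_swap_iff hxy]

/-- inversions persist under an ascending step -/
lemma inv_step {n : ℕ} {x y : Fin n} (hxy : (y : ℕ) = x + 1) {u : Equiv.Perm (Fin n)}
    (hu : u x < u y) {c d : Fin n} (hcd : c < d) (h : u⁻¹ d < u⁻¹ c) :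
    (u * Equiv.swap x y)⁻¹ d < (u * Equiv.swap x y)⁻¹ c := by
  have : ∀ z, (u * Equiv.swap x y)⁻¹ z = Equiv.swap x y (u⁻¹ z) := by intro z; simp
  rw [this, this]
  apply swap_adj_lt hxy h
  rintro ⟨h1, h2⟩
  rw [Equiv.Perm.inv_eq_iff_eq] at h1 h2
  rw [← h1, ← h2] at hu
  exact lt_asymm hu hcd

lemma inv_mono {n : ℕ} (A B : List ℕ) : Asc n (A ++ B) → ∀ {c d : Fin n}, c < d →
    (wprod n A)⁻¹ d < (wprod n A)⁻¹ c → (wprod n (A ++ B))⁻¹ d < (wprod n (A ++ B))⁻¹ c := by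
  induction B using List.reverseRecOn with
  | nil => intro _ c d _ h; simpa using h
  | append_singleton B i ih =>
    intro hR c d hcd h
    rw [← List.append_assoc] at hR ⊢
    obtain ⟨x, y, hxy, hs, hlt⟩ := hR _ i (List.prefix_refl _)
    rw [wprod_snoc, hs]
    exact inv_step hxy hlt hcd (ih (hR.ofPre (List.prefix_append _ _)) hcd h)

/-- the discrepancy invariant along the word -/
lemma disc_main {n : ℕ} {x y : Fin n} (hxy : (y : ℕ) = x + 1) (A : List ℕ) (i : ℕ)
    (hs : sTr n i = Equiv.swap x y) (hlt : wprod n A x < wprod n A y) (θ : ℕ)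
    (h1 : (wprod n A x : ℕ) < θ) (h2 : θ ≤ (wprod n A y : ℕ)) (B : List ℕ) :
    Asc n (A ++ [i] ++ B) →
    Disc θ (fun c => θ ≤ (c : ℕ) ∧ c ≤ wprod n A y ∧ (wprod n (A ++ [i]))⁻¹ c ≤ x)
      (fun c => (c : ℕ) < θ ∧ wprod n A x ≤ c ∧ y ≤ (wprod n (A ++ [i]))⁻¹ c)
      (wprod n (A ++ [i] ++ B)) (dem n (A ++ B)) := by
  induction B using List.reverseRecOn with
  | nil =>
    intro hR
    rw [List.append_nil] at hR
    rw [List.append_nil, List.append_nil, dem_eq_wprod A (hR.ofPre (List.prefix_append _ _))]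
    have hw : wprod n (A ++ [i]) = wprod n A * Equiv.swap x y := by rw [wprod_snoc, hs]
    refine ⟨x, y, ?_, ?_, ?_, ?_, ?_⟩
    · refine ⟨?_, ?_, by simp⟩ <;> simp [hw, h2]
    · rintro p ⟨-, -, h⟩; simpa using h
    · refine ⟨?_, ?_, by simp⟩ <;> simp [hw, h1]
    · rintro p ⟨-, -, h⟩; simpa using h
    · intro p
      rw [hw]
      have hne : x ≠ y := by intro h; rw [h] at hxy; omega
      by_cases hx : p = x
      · subst hx; simp [hne]; omega
      · by_cases hy : p = y
        · subst hy; simp; omega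
        · simp [Equiv.swap_apply_of_ne_of_ne hx hy, hx, hy]
  | append_singleton B j ih =>
    intro hR
    rw [← List.append_assoc] at hR
    have hR' := hR.ofPre (List.prefix_append _ _)
    have ih := ih hR'
    obtain ⟨x', y', hxy', hs', hlt'⟩ := hR _ j (List.prefix_refl _)
    rw [← List.append_assoc, ← List.append_assoc, wprod_snoc n (A ++ [i] ++ B) j, hs', dem_snoc' hxy' _ _ hs']
    have hmono : ∀ {c d : Fin n}, c < d → (wprod n (A ++ [i]))⁻¹ d < (wprod n (A ++ [i]))⁻¹ c →
        (wprod n (A ++ [i] ++ B))⁻¹ d < (wprod n (A ++ [i] ++ B))⁻¹ c :=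
      fun hcd h => inv_mono (A ++ [i]) B hR' hcd h
    have hx'y' : x' < y' := by rw [Fin.lt_def]; omega
    have hle : (wprod n (A ++ [i]))⁻¹ (wprod n (A ++ [i] ++ B) x') ≤
        (wprod n (A ++ [i]))⁻¹ (wprod n (A ++ [i] ++ B) y') := by
      by_contra hcon
      have := hmono hlt' (not_le.mp hcon)
      simp only [inv_app_self] at this
      exact lt_asymm this hx'y'
    refine Disc.step hxy' hlt' (fun c h => h.1) (fun c h => h.1) ?_ ?_ ?_ ih
    · rintro ⟨-, h3, h4⟩ h5
      exact ⟨h5, hlt'.le.trans h3, hle.trans h4⟩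
    · rintro ⟨-, h3, h4⟩ h5
      exact ⟨h5, h3.trans hlt'.le, h4.trans hle⟩
    · rintro p q ⟨h3, h4, h5⟩ ⟨h6, h7, h8⟩
      have hxy2 : x < y := by rw [Fin.lt_def]; omega
      have := hmono (c := wprod n (A ++ [i] ++ B) q) (d := wprod n (A ++ [i] ++ B) p)
        (by rw [Fin.lt_def]; omega) (h5.trans_lt (hxy2.trans_le h8))
      simpa using this

/-- thresholds outside `(a,b]` see no discrepancy -/
lemma same_main {n : ℕ} {x y : Fin n} (hxy : (y : ℕ) = x + 1) (A : List ℕ) (i : ℕ)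
    (hs : sTr n i = Equiv.swap x y) (hlt : wprod n A x < wprod n A y) (θ : ℕ)
    (h1 : θ ≤ (wprod n A x : ℕ) ∨ (wprod n A y : ℕ) < θ) (B : List ℕ) :
    Asc n (A ++ [i] ++ B) → ∀ p,
    (θ ≤ (dem n (A ++ B) p : ℕ) ↔ θ ≤ (wprod n (A ++ [i] ++ B) p : ℕ)) := by
  rw [Fin.lt_def] at hlt
  induction B using List.reverseRecOn with
  | nil =>
    intro hR p
    rw [List.append_nil] at hR
    rw [List.append_nil, List.append_nil, dem_eq_wprod A (hR.ofPre (List.prefix_append _ _))]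
    have hw : wprod n (A ++ [i]) = wprod n A * Equiv.swap x y := by rw [wprod_snoc, hs]
    rw [hw]
    by_cases hx : p = x
    · subst hx; simp; omega
    · by_cases hy : p = y
      · subst hy; simp; omega
      · simp [Equiv.swap_apply_of_ne_of_ne hx hy]
  | append_singleton B j ih =>
    intro hR p
    rw [← List.append_assoc] at hR
    have hR' := hR.ofPre (List.prefix_append _ _)
    have ih := ih hR'
    obtain ⟨x', y', hxy', hs', hlt'⟩ := hR _ j (List.prefix_refl _)
    rw [← List.append_assoc, ← List.append_assoc, wprod_snoc n (A ++ [i] ++ B) j, hs', dem_snoc' hxy' _ _ hs']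
    rw [Fin.lt_def] at hlt'
    by_cases hx : p = x'
    · subst hx
      rw [dstep_bits_x, ih, ih, Equiv.Perm.mul_apply, Equiv.swap_apply_left]; omega
    · by_cases hy : p = y'
      · subst hy
        rw [dstep_bits_y, ih, ih, Equiv.Perm.mul_apply, Equiv.swap_apply_right]; omega
      · rw [dstep_ne _ hx hy, ih]; simp [Equiv.swap_apply_of_ne_of_ne hx hy]

lemma w0_apply {n : ℕ} (p : Fin n) : w0 n p = Fin.rev p := rfl

lemma w0_inv_apply {n : ℕ} (p : Fin n) : (w0 n)⁻¹ p = Fin.rev p := rfl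

lemma fixed_outside {n : ℕ} {x y : Fin n} (hxy : (y : ℕ) = x + 1) (A : List ℕ) (i : ℕ)
    (hs : sTr n i = Equiv.swap x y) (hlt : wprod n A x < wprod n A y) (B : List ℕ)
    (hR : Asc n (A ++ [i] ++ B)) (hw : wprod n (A ++ [i] ++ B) = w0 n) (t : Fin n)
    (ht : t < wprod n A x ∨ wprod n A y < t) : (dem n (A ++ B))⁻¹ t = Fin.rev t := by
  rw [Equiv.Perm.inv_eq_iff_eq]
  rw [Fin.lt_def, Fin.lt_def] at ht
  rw [Fin.lt_def] at hlt
  have h1 := same_main hxy A i hs hlt t (by omega) B hR (Fin.rev t)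
  have h2 := same_main hxy A i hs hlt (t + 1) (by omega) B hR (Fin.rev t)
  rw [hw, w0_apply, Fin.rev_rev] at h1 h2
  apply Fin.ext
  omega

lemma move_a {n : ℕ} {x y : Fin n} (hxy : (y : ℕ) = x + 1) (A : List ℕ) (i : ℕ)
    (hs : sTr n i = Equiv.swap x y) (hlt : wprod n A x < wprod n A y) (B : List ℕ)
    (hR : Asc n (A ++ [i] ++ B)) (hw : wprod n (A ++ [i] ++ B) = w0 n) :
    (dem n (A ++ B))⁻¹ (wprod n A x) ≠ Fin.rev (wprod n A x) := by
  intro h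
  rw [Equiv.Perm.inv_eq_iff_eq] at h
  rw [Fin.lt_def] at hlt
  obtain ⟨P, Q, -, -, ⟨h1, h2, -⟩, -, hb⟩ :=
    disc_main hxy A i hs hlt (wprod n A x + 1) (by omega) (by omega) B hR
  rw [hw, w0_apply] at h1 h2
  have hQ : Fin.rev Q = wprod n A x := by
    apply Fin.ext; rw [Fin.le_def] at h2; omega
  have := (hb Q).mpr (Or.inr rfl)
  rw [← hQ, Fin.rev_rev] at h
  rw [← hQ, ← h] at this
  omega

lemma move_b {n : ℕ} {x y : Fin n} (hxy : (y : ℕ) = x + 1) (A : List ℕ) (i : ℕ)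
    (hs : sTr n i = Equiv.swap x y) (hlt : wprod n A x < wprod n A y) (B : List ℕ)
    (hR : Asc n (A ++ [i] ++ B)) (hw : wprod n (A ++ [i] ++ B) = w0 n) :
    (dem n (A ++ B))⁻¹ (wprod n A y) ≠ Fin.rev (wprod n A y) := by
  intro h
  rw [Equiv.Perm.inv_eq_iff_eq] at h
  rw [Fin.lt_def] at hlt
  obtain ⟨P, Q, ⟨h1, h2, -⟩, -, ⟨h3, -, -⟩, -, hb⟩ :=
    disc_main hxy A i hs hlt (wprod n A y) (by omega) (by omega) B hR
  rw [hw, w0_apply] at h1 h2 h3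
  have hP : Fin.rev P = wprod n A y := by
    apply Fin.ext; rw [Fin.le_def] at h2; omega
  rw [← hP, Fin.rev_rev] at h
  have := (hb P).mp (by rw [← hP, ← h])
  rcases this with h | h
  · exact h.2 rfl
  · subst h; omega

lemma move_left {n : ℕ} {x y : Fin n} (hxy : (y : ℕ) = x + 1) (A : List ℕ) (i : ℕ)
    (hs : sTr n i = Equiv.swap x y) (hlt : wprod n A x < wprod n A y) (B : List ℕ)
    (hR : Asc n (A ++ [i] ++ B)) (hw : wprod n (A ++ [i] ++ B) = w0 n) (e : Fin n)
    (h1 : wprod n A x < e) (h2 : e < wprod n A y) (he : (wprod n (A ++ [i]))⁻¹ e ≤ x) :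
    (dem n (A ++ B))⁻¹ e < Fin.rev e := by
  obtain ⟨P, Q, ⟨a1, a2, a3⟩, ha, ⟨b1, b2, b3⟩, hbm, hb⟩ :=
    disc_main hxy A i hs hlt e (by rw [Fin.lt_def] at h1; omega)
      (by rw [Fin.lt_def] at h2; omega) B hR
  obtain ⟨P', Q', ⟨a1', a2', a3'⟩, ha', ⟨b1', b2', b3'⟩, hbm', hb'⟩ :=
    disc_main hxy A i hs hlt (e + 1) (by rw [Fin.lt_def] at h1; omega)
      (by rw [Fin.lt_def] at h2; omega) B hR
  have hP := ha (Fin.rev e) (by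
    simp only [hw, w0_apply, Fin.rev_rev]
    exact ⟨le_refl _, h2.le, he⟩)
  have hQ1 : Q' ≤ Q := hbm' Q ⟨by omega, b2, b3⟩
  have hQ2 : Q ≤ Q' := by
    refine hbm Q' ⟨?_, b2', b3'⟩
    have : (wprod n (A ++ [i] ++ B) Q') ≠ e := by
      intro h
      rw [h] at b3'
      have := b3'.trans he
      rw [Fin.le_def] at this; omega
    have : (wprod n (A ++ [i] ++ B) Q' : ℕ) ≠ e := fun h => this (Fin.ext h)
    omega
  have hQ := le_antisymm hQ1 hQ2
  by_contra hcon
  rw [not_lt] at hcon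
  obtain ⟨p, hp⟩ : ∃ p, p = (dem n (A ++ B))⁻¹ e := ⟨_, rfl⟩
  rw [← hp] at hcon
  have hv : dem n (A ++ B) p = e := by rw [hp]; simp
  rw [hw, w0_apply] at a1
  rcases (hb p).mp (by rw [hv]) with ⟨h3, h4⟩ | h3
  · apply h4
    rw [hw, w0_apply] at h3
    apply Fin.ext
    simp only [Fin.le_def, Fin.val_rev] at *
    omega
  · have := (hb' p).mpr (Or.inr (by rw [h3, hQ]))
    rw [hv] at this; omega

lemma move_right {n : ℕ} {x y : Fin n} (hxy : (y : ℕ) = x + 1) (A : List ℕ) (i : ℕ)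
    (hs : sTr n i = Equiv.swap x y) (hlt : wprod n A x < wprod n A y) (B : List ℕ)
    (hR : Asc n (A ++ [i] ++ B)) (hw : wprod n (A ++ [i] ++ B) = w0 n) (e : Fin n)
    (h1 : wprod n A x < e) (h2 : e < wprod n A y) (he : y ≤ (wprod n (A ++ [i]))⁻¹ e) :
    Fin.rev e < (dem n (A ++ B))⁻¹ e := by
  obtain ⟨P, Q, ⟨a1, a2, a3⟩, ha, ⟨b1, b2, b3⟩, hbm, hb⟩ :=
    disc_main hxy A i hs hlt e (by rw [Fin.lt_def] at h1; omega)
      (by rw [Fin.lt_def] at h2; omega) B hR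
  obtain ⟨P', Q', ⟨a1', a2', a3'⟩, ha', ⟨b1', b2', b3'⟩, hbm', hb'⟩ :=
    disc_main hxy A i hs hlt (e + 1) (by rw [Fin.lt_def] at h1; omega)
      (by rw [Fin.lt_def] at h2; omega) B hR
  have hQ := hbm' (Fin.rev e) (by
    simp only [hw, w0_apply, Fin.rev_rev]
    exact ⟨Nat.lt_succ_self _, h1.le, he⟩)
  have hP1 : P' ≤ P := ha P' ⟨by omega, a2', a3'⟩
  have hP2 : P ≤ P' := by
    refine ha' P ⟨?_, a2, a3⟩
    have : (wprod n (A ++ [i] ++ B) P) ≠ e := by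
      intro h
      rw [h] at a3
      have := he.trans a3
      rw [Fin.le_def] at this; omega
    have : (wprod n (A ++ [i] ++ B) P : ℕ) ≠ e := fun h => this (Fin.ext h)
    omega
  have hP := le_antisymm hP1 hP2
  by_contra hcon
  rw [not_lt] at hcon
  obtain ⟨p, hp⟩ : ∃ p, p = (dem n (A ++ B))⁻¹ e := ⟨_, rfl⟩
  rw [← hp] at hcon
  have hv : dem n (A ++ B) p = e := by rw [hp]; simp
  have hn := (not_congr (hb' p)).mp (by rw [hv]; omega)
  rw [not_or, not_and_or, not_not] at hn
  obtain ⟨h3, h4⟩ := hn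
  have hpP : p = P := by
    rcases h3 with h3 | h3
    · exfalso
      apply h4
      apply Fin.ext
      rw [hw, w0_apply] at h3 b1'
      simp only [Fin.le_def, Fin.val_rev] at *
      omega
    · rw [h3, hP]
  rcases (hb p).mp (by rw [hv]) with h5 | h5
  · exact h5.2 hpP
  · rw [← hpP] at a1
    rw [← h5] at b1
    omega

lemma posOf_eq {n : ℕ} (x : Equiv.Perm (Fin n)) {t : ℕ} (h1 : 1 ≤ t) (h2 : t ≤ n) :
    posOf x t = (x⁻¹ (⟨t - 1, by omega⟩ : Fin n) : ℕ) + 1 := by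
  simp [posOf, app, h1, h2]

lemma supp_dem {n : ℕ} {x y : Fin n} (hxy : (y : ℕ) = x + 1) (A : List ℕ) (i : ℕ)
    (hs : sTr n i = Equiv.swap x y) (hlt : wprod n A x < wprod n A y) (B : List ℕ)
    (hR : Asc n (A ++ [i] ++ B)) (hw : wprod n (A ++ [i] ++ B) = w0 n) :
    Supp n (dem n (A ++ B)) = Finset.Icc ((wprod n A x : ℕ) + 1) ((wprod n A y : ℕ) + 1) := by
  have hby := (wprod n A y).isLt
  ext t
  simp only [Supp, Finset.mem_filter, Finset.mem_Icc]
  by_cases ht : 1 ≤ t ∧ t ≤ n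
  · obtain ⟨ht1, ht2⟩ := ht
    rw [posOf_eq _ ht1 ht2, posOf_eq _ ht1 ht2, w0_inv_apply]
    obtain ⟨t', ht'⟩ : ∃ t' : Fin n, t' = ⟨t - 1, by omega⟩ := ⟨_, rfl⟩
    have htv : (t' : ℕ) + 1 = t := by rw [ht']; simp only; omega
    rw [← ht']
    have key : (dem n (A ++ B))⁻¹ t' ≠ Fin.rev t' ↔ wprod n A x ≤ t' ∧ t' ≤ wprod n A y := by
      constructor
      · intro h
        by_contra hcon
        apply h
        apply fixed_outside hxy A i hs hlt B hR hw
        rw [not_and_or, not_le, not_le] at hcon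
        exact hcon
      · rintro ⟨h1, h2⟩
        rcases h1.lt_or_eq with h1 | h1
        · rcases h2.lt_or_eq with h2 | h2
          · rcases le_or_gt ((wprod n (A ++ [i]))⁻¹ t') x with h3 | h3
            · exact (move_left hxy A i hs hlt B hR hw t' h1 h2 h3).ne
            · refine (move_right hxy A i hs hlt B hR hw t' h1 h2 ?_).ne'
              rw [Fin.lt_def] at h3
              rw [Fin.le_def]; omega
          · rw [h2]; exact move_b hxy A i hs hlt B hR hw
        · rw [← h1]; exact move_a hxy A i hs hlt B hR hw
    have e1 : ((((dem n (A ++ B))⁻¹ t' : Fin n) : ℕ) + 1 ≠ (Fin.rev t' : ℕ) + 1) ↔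
        (dem n (A ++ B))⁻¹ t' ≠ Fin.rev t' := by
      rw [ne_eq, ne_eq, Fin.ext_iff]; omega
    rw [e1, key, Fin.le_def, Fin.le_def]
    omega
  · constructor
    · intro h; exact absurd h.1 ht
    · intro h; omega

lemma exists_cross {n : ℕ} (R : List ℕ) : Asc n R → ∀ {c d : Fin n}, c < d →
    (wprod n R)⁻¹ d < (wprod n R)⁻¹ c → ∃ A i, (A ++ [i]) <+: R ∧ ∃ x y : Fin n,
      (y : ℕ) = x + 1 ∧ sTr n i = Equiv.swap x y ∧ wprod n A x = c ∧ wprod n A y = d := by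
  induction R using List.reverseRecOn with
  | nil =>
    intro _ c d hcd h
    simp only [wprod, List.map_nil, List.prod_nil, inv_one, Equiv.Perm.one_apply] at h
    exact absurd h (lt_asymm hcd)
  | append_singleton A i ih =>
    intro hR c d hcd h
    by_cases h0 : (wprod n A)⁻¹ d < (wprod n A)⁻¹ c
    · obtain ⟨A', i', hp, h⟩ := ih (hR.ofPre (List.prefix_append _ _)) hcd h0
      exact ⟨A', i', hp.trans (List.prefix_append _ _), h⟩
    · obtain ⟨x, y, hxy, hs, hlt⟩ := hR A i (List.prefix_refl _)
      refine ⟨A, i, List.prefix_refl _, x, y, hxy, hs, ?_⟩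
      rw [wprod_snoc, hs] at h
      have hz : ∀ z, (wprod n A * Equiv.swap x y)⁻¹ z = Equiv.swap x y ((wprod n A)⁻¹ z) := by
        intro z; simp
      rw [hz, hz] at h
      have hne : (wprod n A)⁻¹ c ≠ (wprod n A)⁻¹ d := fun h => hcd.ne ((wprod n A)⁻¹.injective h)
      have hlt0 := lt_of_le_of_ne (not_lt.mp h0) hne
      by_contra hcon
      apply lt_asymm h
      apply swap_adj_lt hxy hlt0
      rintro ⟨h1, h2⟩
      apply hcon
      rw [← h1, ← h2]
      simp

lemma cross_unique {n : ℕ} {R A A' : List ℕ} {i i' : ℕ} (hR : Asc n R) (h : (A ++ [i]) <+: R)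
    (h' : (A' ++ [i']) <+: R) (hl : A.length < A'.length) {x y x' y' : Fin n}
    (hxy : (y : ℕ) = x + 1) (hs : sTr n i = Equiv.swap x y) (hxy' : (y' : ℕ) = x' + 1)
    (hlt : wprod n A x < wprod n A y)
    (h1 : wprod n A x = wprod n A' x') (h2 : wprod n A y = wprod n A' y') : False := by
  have hA' : A' <+: R := (List.prefix_append _ _).trans h'
  have hp : (A ++ [i]) <+: A' := List.prefix_of_prefix_length_le h hA' (by simp; omega)
  obtain ⟨B, rfl⟩ := hp
  have := inv_mono (A ++ [i]) B (hR.ofPre hA') hlt (by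
    rw [wprod_snoc, hs]
    simp only [mul_inv_rev, Equiv.swap_inv, Equiv.Perm.mul_apply, inv_app_self,
      Equiv.swap_apply_left, Equiv.swap_apply_right]
    rw [Fin.lt_def]; omega)
  rw [h1, h2] at this
  simp only [inv_app_self, Fin.lt_def] at this
  omega

lemma isInversion_iff {n : ℕ} (u : Equiv.Perm (Fin n)) (a b : Fin n) :
    IsInversion u (a + 1) (b + 1) ↔ u⁻¹ b < u⁻¹ a := by
  unfold IsInversion
  rw [posOf_eq _ (by omega) (by omega), posOf_eq _ (by omega) (by omega), Fin.lt_def]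
  simp

lemma tau_lt_tau {n : ℕ} {R S : List ℕ} (hR : Asc n R) (hS : S <+: R) {a b c d : Fin n}
    (hcd : c < d) (h1 : (wprod n S)⁻¹ b < (wprod n S)⁻¹ a)
    (h2 : ¬ (wprod n S)⁻¹ d < (wprod n S)⁻¹ c) (h3 : (wprod n R)⁻¹ d < (wprod n R)⁻¹ c) :
    tau n R (a + 1) (b + 1) < tau n R (c + 1) (d + 1) := by
  have hSt : S = R.take S.length := List.prefix_iff_eq_take.mp hS
  have e1 : tau n R (a + 1) (b + 1) ≤ S.length := by
    apply Nat.sInf_le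
    rw [Set.mem_ofPred_eq, ← hSt, isInversion_iff]
    exact h1
  have e2 : IsInversion (wprod n (R.take (tau n R (c + 1) (d + 1)))) (c + 1) (d + 1) := by
    apply Nat.sInf_mem (s := {k | IsInversion (wprod n (R.take k)) (c + 1) (d + 1)})
    refine ⟨R.length, ?_⟩
    rw [Set.mem_ofPred_eq, List.take_length, isInversion_iff]
    exact h3
  rw [isInversion_iff] at e2
  refine lt_of_le_of_lt e1 ?_
  by_contra hcon
  apply h2
  have hp : R.take (tau n R (c + 1) (d + 1)) <+: S := by
    apply List.prefix_of_prefix_length_le (List.take_prefix _ _) hS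
    rw [List.length_take]; omega
  obtain ⟨B, hB⟩ := hp
  rw [← hB]
  exact inv_mono _ B (by rw [hB]; exact hR.ofPre hS) hcd e2

lemma D_eq {n : ℕ} (hn : 3 ≤ n) {R : List ℕ} (hred : IsReducedWordFor n R (w0 n))
    (u : Equiv.Perm (Fin n)) :
    D n R u = ∑ k ∈ Finset.range R.length, if dem n (R.eraseIdx k) = u then (1 : ℤ) else 0 := by
  obtain ⟨⟨hal, hl⟩, hw⟩ := hred
  rw [← wt_coeff_sub R (asc_of_reduced R ⟨hal, hl⟩)]
  have hl2 := hl
  rw [hw, len_w0] at hl2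
  unfold D
  rw [← hl2]
  have hpos : 0 < R.length := by
    rw [hl2]
    apply Nat.div_pos _ (by norm_num)
    have : 1 ≤ n - 1 := by omega
    nlinarith
  obtain ⟨m, hm⟩ : ∃ m, R.length = m + 1 := ⟨R.length - 1, by omega⟩
  rw [hm, Polynomial.coeff_X_mul]
  rfl

lemma Theta_eq {n : ℕ} (hn : 3 ≤ n) {R : List ℕ} (hred : IsReducedWordFor n R (w0 n))
    (a b c : ℕ) :
    Theta n R a b c = ∑ k ∈ Finset.range R.length,
      if Supp n (dem n (R.eraseIdx k)) = Finset.Icc a c then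
        sigmaVal n b (dem n (R.eraseIdx k)) else 0 := by
  unfold Theta
  simp only [D_eq hn hred, Finset.sum_mul]
  rw [Finset.sum_comm]
  apply Finset.sum_congr rfl
  intro k _
  rw [Finset.sum_filter]
  rw [Finset.sum_eq_single (dem n (R.eraseIdx k))]
  · simp
  · intro u _ hu
    rw [if_neg (c := dem n (R.eraseIdx k) = u) (Ne.symm hu)]
    simp
  · simp

/-- For every reduced word `R` of the longest element
`w₀ ∈ S_n` (`n ≥ 3`) and every triple `1 ≤ d < e < f ≤ n`,
`Θ_R(d,e,f) = −T_R(d,e,f)`; equivalently `Θ_R(d,e,f) + T_R(d,e,f)` is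
independent of `R` and equals `0`. -/
theorem theta_eq_neg_T
    (n : ℕ) (hn : 3 ≤ n) (R : List ℕ)
    (hred : IsReducedWordFor n R (w0 n))
    (d e f : ℕ) (hd : 1 ≤ d) (hde : d < e) (hef : e < f) (hf : f ≤ n) :
    Theta n R d e f = - T n R d e f := by
  have hasc := asc_of_reduced R hred.1
  have hw := hred.2
  obtain ⟨d', rfl⟩ : ∃ d' : Fin n, d = d' + 1 := ⟨⟨d - 1, by omega⟩, by simp only; omega⟩
  obtain ⟨e', rfl⟩ : ∃ e' : Fin n, e = e' + 1 := ⟨⟨e - 1, by omega⟩, by simp only; omega⟩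
  obtain ⟨f', rfl⟩ : ∃ f' : Fin n, f = f' + 1 := ⟨⟨f - 1, by omega⟩, by simp only; omega⟩
  have hde' : d' < e' := by rw [Fin.lt_def]; omega
  have hef' : e' < f' := by rw [Fin.lt_def]; omega
  have hinv : ∀ {c d : Fin n}, c < d → (wprod n R)⁻¹ d < (wprod n R)⁻¹ c := by
    intro c d h
    rw [hw, w0_inv_apply, w0_inv_apply, Fin.rev_lt_rev]
    exact h
  obtain ⟨A, i, hp, x, y, hxy, hs, hx, hy⟩ := exists_cross R hasc (hde'.trans hef') (hinv (hde'.trans hef'))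
  have hlt : wprod n A x < wprod n A y := by rw [hx, hy]; exact hde'.trans hef'
  obtain ⟨B, hB⟩ := hp
  have hp : (A ++ [i]) <+: R := ⟨B, hB⟩
  rw [Theta_eq hn hred]
  have hlen : A.length < R.length := by rw [← hB]; simp
  have herase : R.eraseIdx A.length = A ++ B := by
    rw [← hB, List.append_assoc, List.eraseIdx_append_of_length_le (le_refl _)]; simp
  have hascB : Asc n (A ++ [i] ++ B) := by rw [hB]; exact hasc
  have hwB : wprod n (A ++ [i] ++ B) = w0 n := by rw [hB]; exact hw
  rw [Finset.sum_eq_single A.length]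
  · rw [herase, supp_dem hxy A i hs hlt B hascB hwB, hx, hy, if_pos rfl]
    have hw1 : ∀ z, (wprod n (A ++ [i]))⁻¹ z = Equiv.swap x y ((wprod n A)⁻¹ z) := by
      intro z; rw [wprod_snoc, hs]; simp
    have hd1 : (wprod n (A ++ [i]))⁻¹ d' = y := by rw [hw1, ← hx]; simp
    have hf1 : (wprod n (A ++ [i]))⁻¹ f' = x := by rw [hw1, ← hy]; simp
    have hne : (wprod n (A ++ [i]))⁻¹ e' ≠ x := by
      rw [← hf1]; exact fun h => hef'.ne ((wprod n (A ++ [i]))⁻¹.injective h)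
    have hne2 : (wprod n (A ++ [i]))⁻¹ e' ≠ y := by
      rw [← hd1]; exact fun h => hde'.ne' ((wprod n (A ++ [i]))⁻¹.injective h)
    unfold sigmaVal T
    rw [posOf_eq _ (by omega) (by omega), posOf_eq _ (by omega) (by omega), w0_inv_apply]
    simp only [Nat.add_sub_cancel, Fin.eta]
    rcases le_or_gt ((wprod n (A ++ [i]))⁻¹ e') x with h3 | h3
    · have h4 := move_left hxy A i hs hlt B hascB hwB e' (by rw [hx]; exact hde')
        (by rw [hy]; exact hef') h3
      rw [if_pos]
      · apply Int.sign_eq_neg_one_of_neg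
        rw [Fin.lt_def] at h4
        omega
      · apply tau_lt_tau hasc hp hef'
        · rw [hd1]; rw [Fin.le_def] at h3; rw [Fin.lt_def]; omega
        · rw [hf1]; exact not_lt.mpr h3
        · exact hinv hef'
    · have h5 : y ≤ (wprod n (A ++ [i]))⁻¹ e' := by
        rw [Fin.lt_def] at h3; rw [Fin.le_def]; omega
      have h4 := move_right hxy A i hs hlt B hascB hwB e' (by rw [hx]; exact hde')
        (by rw [hy]; exact hef') h5
      rw [if_neg]
      · rw [neg_neg]
        apply Int.sign_eq_one_of_pos
        rw [Fin.lt_def] at h4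
        omega
      · apply not_lt.mpr
        apply le_of_lt
        apply tau_lt_tau hasc hp hde'
        · rw [hf1]; exact h3
        · rw [hd1]; exact not_lt.mpr h5
        · exact hinv hde'
  · intro k hk hkne
    rw [Finset.mem_range] at hk
    have hsplit : R.take k ++ [R[k]] ++ R.drop (k + 1) = R := by
      simp
    have hp' : (R.take k ++ [R[k]]) <+: R := ⟨_, hsplit⟩
    obtain ⟨x', y', hxy', hs', hlt'⟩ := hasc _ _ hp'
    have hl' : (R.take k).length = k := by rw [List.length_take]; omega
    rw [if_neg]
    rw [List.eraseIdx_eq_take_drop_succ, supp_dem hxy' _ _ hs' hlt' _ (by rw [hsplit]; exact hasc)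
      (by rw [hsplit]; exact hw)]
    intro hIcc
    have hlt2 := hlt'
    rw [Fin.lt_def] at hlt2
    have hIcc2 := congrArg (fun s : Finset ℕ => (s : Set ℕ)) hIcc
    simp only [Finset.coe_Icc] at hIcc2
    have h12 := (Set.Icc_eq_Icc_iff (by omega)).mp hIcc2
    have e1 : wprod n (R.take k) x' = wprod n A x := by
      rw [hx]; apply Fin.ext; omega
    have e2 : wprod n (R.take k) y' = wprod n A y := by
      rw [hy]; apply Fin.ext; omega
    rcases lt_or_gt_of_ne hkne with h | h
    · exact cross_unique hasc hp' hp (by omega) hxy' hs' hxy hlt' e1 e2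
    · exact cross_unique hasc hp hp' (by omega) hxy hs hxy' hlt e1.symm e2.symm
  · intro h
    exact absurd (Finset.mem_range.mpr hlen) h

end BSDist
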